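/- (Derivative estimate for H) Let κ ≤ 0, let n ≥ 2 be an integer, and let F solve the ODE of the paper with F(0) = 0, F'(0) = 1. Define H(r) := F'(r)² + (n−1) F(r)²/sn_κ(r)². Then for every r > 0, H'(r) ≤ −(2(n−1)/sn_κ(r)³) ( sn_κ(r) F'(r) − F(r) )² ≤ 0. -/

import Mathlib

open Set

/-- The comparison sine function `sn_κ` for `κ ≤ 0`: `sn_0(t) = t` and
`sn_κ(t) = sinh(√(-κ) t)/√(-κ)` for `κ < 0`. -/
noncomputable def snk (κ : ℝ) (t : ℝ) : ℝ :=
  if κ = 0 then t else Real.sinh (Real.sqrt (-κ) * t) / Real.sqrt (-κ)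

theorem snk_facts (κ : ℝ) (hκ : κ ≤ 0) (r : ℝ) (hr : 0 < r) :
    0 < snk κ r ∧ ∃ d, HasDerivAt (snk κ) d r ∧ 1 ≤ d := by
  by_cases h : κ = 0
  · have e : snk κ = fun t => t := by
      funext t; simp [snk, h]
    rw [e]
    exact ⟨hr, 1, hasDerivAt_id r, le_refl _⟩
  · have hk : 0 < Real.sqrt (-κ) := Real.sqrt_pos.mpr (by
      have := lt_of_le_of_ne hκ h
      linarith)
    have e : snk κ = fun t => Real.sinh (Real.sqrt (-κ) * t) / Real.sqrt (-κ) := by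
      funext t; simp [snk, h]
    rw [e]
    refine ⟨div_pos (Real.sinh_pos_iff.mpr (mul_pos hk hr)) hk,
      Real.cosh (Real.sqrt (-κ) * r), ?_, Real.one_le_cosh _⟩
    have h1 := (((hasDerivAt_id' r).const_mul (Real.sqrt (-κ))).sinh).div_const (Real.sqrt (-κ))
    have h2 : Real.cosh (Real.sqrt (-κ) * r) =
        Real.cosh (Real.sqrt (-κ) * r) * (Real.sqrt (-κ) * 1) / Real.sqrt (-κ) := by
      field_simp
    rw [h2]
    exact h1

/-- Derivative estimate for `H(r) = F'(r)² + (n-1) F(r)²/sn_κ(r)²`: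
`H'(r) ≤ -(2(n-1)/sn_κ(r)³)(sn_κ(r) F'(r) - F(r))² ≤ 0` for every `r > 0`. -/
theorem deriv_H_nonpos_estimate
    (κ : ℝ) (hκ : κ ≤ 0) (n : ℕ) (hn : 2 ≤ n) (F : ℝ → ℝ)
    (hFc : ContinuousOn F (Ici 0))
    (hF2 : ContDiffOn ℝ 2 F (Ioi 0))
    (hF0 : F 0 = 0)
    (hF'0 : HasDerivWithinAt F 1 (Ici 0) 0)
    (hODE : ∀ r > 0, deriv (deriv F) r
      + ((n : ℝ) - 1) * (deriv (snk κ) r / snk κ r) * deriv F r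
      - (((n : ℝ) - 1) / (snk κ r) ^ 2) * F r = 0)
    (H : ℝ → ℝ)
    (hH : ∀ r, H r = (deriv F r) ^ 2 + ((n : ℝ) - 1) * (F r) ^ 2 / (snk κ r) ^ 2) :
    ∀ r > 0,
      deriv H r ≤ -(2 * ((n : ℝ) - 1) / (snk κ r) ^ 3) * (snk κ r * deriv F r - F r) ^ 2 ∧
      -(2 * ((n : ℝ) - 1) / (snk κ r) ^ 3) * (snk κ r * deriv F r - F r) ^ 2 ≤ 0 := by
  intro r hr
  obtain ⟨hs, d, hd, hd1⟩ := snk_facts κ hκ r hr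
  have hn' : (1 : ℝ) ≤ (n : ℝ) - 1 := by
    have : (2 : ℝ) ≤ (n : ℝ) := by exact_mod_cast hn
    linarith
  have hFd : HasDerivAt F (deriv F r) r :=
    ((hF2.differentiableOn (by norm_num)).differentiableAt (Ioi_mem_nhds hr)).hasDerivAt
  have hF' : ContDiffOn ℝ 1 (deriv F) (Ioi 0) :=
    hF2.deriv_of_isOpen isOpen_Ioi (by norm_num)
  have hFdd : HasDerivAt (deriv F) (deriv (deriv F) r) r :=
    ((hF'.differentiableOn (by norm_num)).differentiableAt (Ioi_mem_nhds hr)).hasDerivAt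
  have hode := hODE r hr
  rw [hd.deriv] at hode
  have hHe : H = fun r => (deriv F r) ^ 2 + ((n : ℝ) - 1) * (F r) ^ 2 / (snk κ r) ^ 2 :=
    funext hH
  have hD := (hFdd.fun_pow 2).fun_add
    (((hFd.fun_pow 2).const_mul ((n : ℝ) - 1)).fun_div (hd.fun_pow 2) (pow_pos hs 2).ne')
  rw [hHe, hD.deriv]
  generalize deriv (deriv F) r = c at *
  generalize deriv F r = b at *
  generalize F r = a at *
  generalize snk κ r = s at *
  generalize (n : ℝ) - 1 = m at *
  have hc : c = -(m * (d / s) * b) + m / s ^ 2 * a := by linarith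
  have h2 : 0 ≤ 2 * m / s ^ 3 := by positivity
  constructor
  · rw [← sub_nonneg]
    have : 0 ≤ 2 * m / s ^ 3 * ((d - 1) * (s ^ 2 * b ^ 2 + a ^ 2)) :=
      mul_nonneg h2 (mul_nonneg (by linarith) (by positivity))
    convert this using 1
    rw [hc]
    push_cast
    field_simp
    ring
  · have := mul_nonneg h2 (sq_nonneg (s * b - a))
    linarith
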